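/- arXiv:2602.08899 — 3 statements merged into one kernel-verified Lean document; each statement's English description precedes it below -/
import Mathlib

section
/- (Proposition C.1(ii) of the paper.) Let K_W ⊆ ℝ^k be compact, μ₀ = (μ₀₁, μ₀₋') ∈ ℝ^{1+k} with μ₀₁ ≠ 0, and let N(μ₀) be a compact neighborhood of μ₀ on which the first coordinate μ₁ is bounded away from 0. With Δ = w'μ₋ + αμ₁ and Λ(x) = e^x/(1+e^x), the (1+k)×(1+k)-matrix-valued function ∂³m(w,D,α,μ)/∂α²∂μ' = −μ₁²·e^{Δ}(e^{2Δ} − 4e^{Δ} + 1)/(1+e^{Δ})⁴·[[α², αw'],[αw, ww']] − 2μ₁·e^{Δ}(1−e^{Δ})/(1+e^{Δ})³·[[α, w'],[0, 0]] − [[2Λ(1−Λ) + 2αμ₁Λ(1−Λ)(1−e^{Δ})/(1+e^{Δ}), 0'],[2μ₁Λ(1−Λ)(1−e^{Δ})/(1+e^{Δ})·w, 0]] is uniformly bounded in norm over (α, w, μ) ∈ ℝ × K_W × N(μ₀). -/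
open Real Matrix

noncomputable section

/-- The logistic function `Λ(x) = eˣ/(1+eˣ)`. -/
def logisticFn (x : ℝ) : ℝ := Real.exp x / (1 + Real.exp x)

/-- The linear index `Δ(w,α,μ) = w'μ₋ + αμ₁` of the logit model. -/
def logitIndex (k : ℕ) (w : Fin k → ℝ) (α μ1 : ℝ) (μm : Fin k → ℝ) : ℝ :=
  w ⬝ᵥ μm + α * μ1

/-- The third mixed partial derivative `∂³m(w,D,α,μ)/∂α²∂μ'` of the logit moment function,
as a `(1+k) × (1+k)` matrix-valued function:
`−μ₁²·e^Δ(e^{2Δ} − 4e^Δ + 1)/(1+e^Δ)⁴·[[α², αw'],[αw, ww']]`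
`− 2μ₁·e^Δ(1−e^Δ)/(1+e^Δ)³·[[α, w'],[0, 0]]`
`− [[2Λ(1−Λ) + 2αμ₁Λ(1−Λ)(1−e^Δ)/(1+e^Δ), 0'],[2μ₁Λ(1−Λ)(1−e^Δ)/(1+e^Δ)·w, 0]]`. -/
def logitThirdDeriv (k : ℕ) (α : ℝ) (w : Fin k → ℝ) (μ1 : ℝ) (μm : Fin k → ℝ) :
    Fin (k + 1) → Fin (k + 1) → ℝ :=
  let Δ : ℝ := logitIndex k w α μ1 μm
  let Λ : ℝ := logisticFn Δ
  let v : Fin (k + 1) → ℝ := Fin.cons α w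
  fun i j =>
    -(μ1 ^ 2) * (Real.exp Δ * (Real.exp (2 * Δ) - 4 * Real.exp Δ + 1) /
        (1 + Real.exp Δ) ^ 4) * (v i * v j) +
    -(2 * μ1) * (Real.exp Δ * (1 - Real.exp Δ) / (1 + Real.exp Δ) ^ 3) *
        (if i = 0 then v j else 0) +
    -(if j = 0 then
        (Fin.cons
          (2 * Λ * (1 - Λ) +
            2 * α * μ1 * Λ * (1 - Λ) * ((1 - Real.exp Δ) / (1 + Real.exp Δ)))
          (fun i' : Fin k =>
            2 * μ1 * Λ * (1 - Λ) * ((1 - Real.exp Δ) / (1 + Real.exp Δ)) * w i') : Fin (k + 1) → ℝ) i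
      else 0)

lemma aux_p_bound (x : ℝ) : 0 ≤ Real.exp x / (1 + Real.exp x) ^ 2 ∧
    Real.exp x / (1 + Real.exp x) ^ 2 ≤ 1 ∧
    Real.exp x / (1 + Real.exp x) ^ 2 * x ^ 2 ≤ 2 := by
  have he := Real.exp_pos x
  refine ⟨by positivity, ?_, ?_⟩
  · rw [div_le_one (by positivity)]
    nlinarith
  · rw [div_mul_eq_mul_div, div_le_iff₀ (by positivity)]
    rcases le_total 0 x with h | h
    · have := Real.quadratic_le_exp_of_nonneg h
      nlinarith
    · have h2 := Real.quadratic_le_exp_of_nonneg (neg_nonneg.2 h)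
      have h3 : Real.exp x * Real.exp (-x) = 1 := by rw [← Real.exp_add]; simp
      nlinarith

lemma aux_r_bound (e : ℝ) (he : 0 < e) : |(1 - e) / (1 + e)| ≤ 1 := by
  rw [abs_le]
  constructor
  · rw [le_div_iff₀ (by positivity)]; linarith
  · rw [div_le_iff₀ (by positivity)]; linarith

lemma aux_q_bound (e : ℝ) (he : 0 < e) : |(e ^ 2 - 4 * e + 1) / (1 + e) ^ 2| ≤ 1 := by
  rw [abs_le]
  constructor
  · rw [le_div_iff₀ (by positivity)]; nlinarith [sq_nonneg (e - 1)]
  · rw [div_le_iff₀ (by positivity)]; nlinarith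

lemma aux_eq (k : ℕ) (α : ℝ) (w : Fin k → ℝ) (μ1 : ℝ) (μm : Fin k → ℝ) (i j : Fin (k + 1))
    (e p q r : ℝ) (he : e = Real.exp (logitIndex k w α μ1 μm))
    (hp : p = e / (1 + e) ^ 2) (hq : q = (e ^ 2 - 4 * e + 1) / (1 + e) ^ 2)
    (hr : r = (1 - e) / (1 + e)) (u : Fin (k + 1) → ℝ)
    (hu : u = fun i => μ1 * (Fin.cons α w : Fin (k + 1) → ℝ) i) :
    logitThirdDeriv k α w μ1 μm i j =
      -(q * (p * (u i * u j))) + -(2 * (r * (p * (if i = 0 then u j else 0)))) +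
      -(if j = 0 then (if i = 0 then 2 * p else 0) + 2 * (r * (p * u i)) else 0) := by
  have hepos : 0 < e := he ▸ Real.exp_pos _
  have h2 : Real.exp (2 * logitIndex k w α μ1 μm) = e ^ 2 := by
    rw [he, ← Real.exp_nat_mul]; norm_num
  have hL : e / (1 + e) * (1 - e / (1 + e)) = p := by
    rw [hp]; field_simp; ring
  have hne : 1 + e ≠ 0 := by positivity
  simp only [logitThirdDeriv, logisticFn, h2, ← he]
  rw [← hr]
  have e1 : e * (e ^ 2 - 4 * e + 1) / (1 + e) ^ 4 = p * q := by
    rw [hp, hq]; field_simp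
  have e2 : e * (1 - e) / (1 + e) ^ 3 = p * r := by
    rw [hp, hr]; field_simp
  rw [e1, e2]
  have e3 : ∀ c : ℝ, c * (e / (1 + e)) * (1 - e / (1 + e)) = c * p := by
    intro c; rw [mul_assoc, hL]
  simp only [e3, hu]
  congr 1
  · congr 1
    · ring
    · split_ifs <;> ring
  · congr 1
    split_ifs with h h'
    · subst h'; simp only [Fin.cons_zero]; ring
    · obtain ⟨i', rfl⟩ := Fin.exists_succ_eq.2 h'
      simp only [Fin.cons_succ]; ring
    · rfl

lemma aux_final (p q r x y P a b : ℝ) (hp : 0 ≤ p) (hp1 : p ≤ 1) (hq : |q| ≤ 1) (hr : |r| ≤ 1)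
    (hx : p * x ^ 2 ≤ P) (hy : p * y ^ 2 ≤ P) (ha : a = 0 ∨ a = y)
    (hb : b = 0 ∨ b = 2 * (r * (p * x)) ∨ b = 2 * p + 2 * (r * (p * x))) :
    |-(q * (p * (x * y))) + -(2 * (r * (p * a))) + -b| ≤ 3 * P + 4 := by
  have hP : 0 ≤ P := le_trans (by positivity) hx
  have key : ∀ z, p * z ^ 2 ≤ P → |2 * (r * (p * z))| ≤ 1 + P := by
    intro z hz
    have h1 : |2 * (p * z)| ≤ 1 + P := by
      rw [abs_le]; constructor <;> nlinarith [mul_nonneg hp (sq_nonneg (z - 1)),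
        mul_nonneg hp (sq_nonneg (z + 1))]
    have : 2 * (r * (p * z)) = r * (2 * (p * z)) := by ring
    rw [this, abs_mul]
    exact (mul_le_of_le_one_left (abs_nonneg _) hr).trans h1
  have t1 : |q * (p * (x * y))| ≤ P := by
    rw [abs_mul]
    refine (mul_le_of_le_one_left (abs_nonneg _) hq).trans ?_
    rw [abs_le]; constructor <;> nlinarith [mul_nonneg hp (sq_nonneg (x - y)),
        mul_nonneg hp (sq_nonneg (x + y))]
  have t2 : |2 * (r * (p * a))| ≤ 1 + P := by
    apply key; rcases ha with rfl | rfl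
    · simpa using hP
    · exact hy
  have t3 : |b| ≤ 3 + P := by
    have := abs_le.1 (key x hx)
    rcases hb with rfl | rfl | rfl
    · simp; linarith
    · rw [abs_le]; constructor <;> linarith
    · rw [abs_le]; constructor <;> linarith
  rw [abs_le] at *
  constructor <;> linarith

/-- **Proposition C.1 (ii).**  Let `K_W ⊆ ℝᵏ` be compact, `μ₀ = (μ₀₁, μ₀₋)` with `μ₀₁ ≠ 0`,
and let `N(μ₀)` be a compact neighborhood of `μ₀` on which the first coordinate is bounded
away from `0`.  Then the matrix-valued map `∂³m/∂α²∂μ'` of the logit moment function is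
uniformly bounded (entrywise, hence in norm) over `(α, w, μ) ∈ ℝ × K_W × N(μ₀)`. -/
theorem logit_third_deriv_uniformly_bounded
    (k : ℕ) (KW : Set (Fin k → ℝ)) (hKW : IsCompact KW)
    (μ01 : ℝ) (μ0m : Fin k → ℝ) (hμ01 : μ01 ≠ 0)
    (Nμ : Set (ℝ × (Fin k → ℝ))) (hNμc : IsCompact Nμ)
    (hNμnhds : Nμ ∈ nhds (μ01, μ0m))
    (hNμaway : ∃ δ : ℝ, 0 < δ ∧ ∀ μ ∈ Nμ, δ ≤ |μ.1|) :
    ∃ M : ℝ, ∀ (α : ℝ), ∀ w ∈ KW, ∀ μ ∈ Nμ, ∀ i j : Fin (k + 1),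
      |logitThirdDeriv k α w μ.1 μ.2 i j| ≤ M := by
  obtain ⟨A, hA⟩ := hKW.exists_bound_of_continuousOn (f := fun w => w) continuousOn_id
  obtain ⟨B, hB⟩ := hNμc.exists_bound_of_continuousOn (f := fun μ => μ.1) continuousOn_fst
  obtain ⟨C, hC⟩ := (hKW.prod hNμc).exists_bound_of_continuousOn
    (f := fun z : (Fin k → ℝ) × (ℝ × (Fin k → ℝ)) => z.1 ⬝ᵥ z.2.2)
    (by unfold dotProduct; fun_prop)
  refine ⟨3 * (4 + 2 * C ^ 2 + (B * A) ^ 2) + 4, ?_⟩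
  intro α w hw μ hμ i j
  have hA' := hA w hw
  have hB' := hB μ hμ
  have hC' : |w ⬝ᵥ μ.2| ≤ C := hC (w, μ) ⟨hw, hμ⟩
  rw [Real.norm_eq_abs] at hB'
  have hB0 : 0 ≤ B := (abs_nonneg _).trans hB'
  obtain ⟨hp0, hp1, hp2⟩ := aux_p_bound (logitIndex k w α μ.1 μ.2)
  have he := Real.exp_pos (logitIndex k w α μ.1 μ.2)
  rw [aux_eq k α w μ.1 μ.2 i j _ _ _ _ rfl rfl rfl rfl _ rfl]
  have hu : ∀ i : Fin (k + 1), Real.exp (logitIndex k w α μ.1 μ.2) /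
      (1 + Real.exp (logitIndex k w α μ.1 μ.2)) ^ 2 *
      (μ.1 * (Fin.cons α w : Fin (k + 1) → ℝ) i) ^ 2 ≤ 4 + 2 * C ^ 2 + (B * A) ^ 2 := by
    intro i
    generalize Real.exp (logitIndex k w α μ.1 μ.2) /
      (1 + Real.exp (logitIndex k w α μ.1 μ.2)) ^ 2 = p at hp0 hp1 hp2 ⊢
    refine Fin.cases ?_ (fun i' => ?_) i
    · simp only [Fin.cons_zero]
      have hc2 : (w ⬝ᵥ μ.2) ^ 2 ≤ C ^ 2 := sq_le_sq' (abs_le.1 hC').1 (abs_le.1 hC').2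
      unfold logitIndex at hp2
      generalize w ⬝ᵥ μ.2 = c at *
      have h1 : (μ.1 * α) ^ 2 ≤ 2 * (c + α * μ.1) ^ 2 + 2 * c ^ 2 := by
        nlinarith [sq_nonneg (2 * c + α * μ.1)]
      have h2 := mul_le_mul_of_nonneg_left h1 hp0
      have h3 : p * c ^ 2 ≤ c ^ 2 := mul_le_of_le_one_left (sq_nonneg _) hp1
      nlinarith [sq_nonneg (B * A)]
    · simp only [Fin.cons_succ]
      have h0 : |w i'| ≤ A := (norm_le_pi_norm w i').trans hA'
      have h1 : |μ.1 * w i'| ≤ B * A := by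
        rw [abs_mul]; exact mul_le_mul hB' h0 (abs_nonneg _) hB0
      have h2 : (μ.1 * w i') ^ 2 ≤ (B * A) ^ 2 := sq_le_sq' (abs_le.1 h1).1 (abs_le.1 h1).2
      have h3 := mul_le_of_le_one_left (sq_nonneg (μ.1 * w i')) hp1
      nlinarith [sq_nonneg C]
  apply aux_final _ _ _ _ _ _ _ _ hp0 hp1 (aux_q_bound _ he) (aux_r_bound _ he) (hu i) (hu j)
  · split_ifs <;> simp
  · split_ifs <;> simp
end
end

section
/- (Proposition C.1(iii) of the paper.) Let K_W ⊆ ℝ^k be compact, μ₀ = (μ₀₁, μ₀₋') ∈ ℝ^{1+k} with μ₀₁ ≠ 0, and let N(μ₀) be a compact neighborhood of μ₀ on which the first coordinate μ₁ is bounded away from 0. With Δ = w'μ₋ + αμ₁ and Λ(x) = e^x/(1+e^x), the squared Frobenius norm of ∂²m(w,D,α,μ)/∂α∂μ' = −μ₁Λ(1−Λ)(1−e^{Δ})/(1+e^{Δ})·[[α², αw'],[αw, ww']] − Λ(1−Λ)·[[2α, w'],[w, 0]] is uniformly bounded over (α, w, μ) ∈ ℝ × K_W × N(μ₀) by a finite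 constant; in particular there is a bounded (hence integrable) function F(w) with sup_{α∈ℝ, μ∈N(μ₀)}‖∂²m(w,D,α,μ)/∂α∂μ'‖² ≤ F(w) for all w ∈ K_W. -/
open Real Matrix

noncomputable section

/-- The second mixed partial derivative `∂²m(w,D,α,μ)/∂α∂μ'` of the logit moment function:
`−μ₁Λ(1−Λ)(1−e^Δ)/(1+e^Δ)·[[α², αw'],[αw, ww']] − Λ(1−Λ)·[[2α, w'],[w, 0]]`. -/
def logitSecondMixedDeriv (k : ℕ) (α : ℝ) (w : Fin k → ℝ) (μ1 : ℝ) (μm : Fin k → ℝ) :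
    Fin (k + 1) → Fin (k + 1) → ℝ :=
  let Δ : ℝ := logitIndex k w α μ1 μm
  let Λ : ℝ := logisticFn Δ
  let v : Fin (k + 1) → ℝ := Fin.cons α w
  let S : Fin (k + 1) → Fin (k + 1) → ℝ :=
    Fin.cons (Fin.cons (2 * α) w) (fun i' : Fin k => Fin.cons (w i') (fun _ : Fin k => 0))
  fun i j =>
    -μ1 * Λ * (1 - Λ) * ((1 - Real.exp Δ) / (1 + Real.exp Δ)) * (v i * v j) -
      Λ * (1 - Λ) * S i j

/-- The squared Frobenius norm of a `(1+k) × (1+k)` real matrix. -/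
def frobSq (k : ℕ) (A : Fin (k + 1) → Fin (k + 1) → ℝ) : ℝ :=
  ∑ i, ∑ j, (A i j) ^ 2

theorem aux_L_eq (x : ℝ) : logisticFn x * (1 - logisticFn x) = Real.exp x / (1 + Real.exp x) ^ 2 := by
  unfold logisticFn
  have h : 0 < 1 + Real.exp x := by positivity
  field_simp
  ring

theorem aux_L_nonneg (x : ℝ) : 0 ≤ logisticFn x * (1 - logisticFn x) := by
  rw [aux_L_eq]; positivity

theorem aux_L_le_one (x : ℝ) : logisticFn x * (1 - logisticFn x) ≤ 1 := by
  nlinarith [sq_nonneg (logisticFn x - 1 / 2)]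

theorem aux_L_sq (x : ℝ) : logisticFn x * (1 - logisticFn x) * x ^ 2 ≤ 2 := by
  rw [aux_L_eq, div_mul_eq_mul_div, div_le_iff₀ (by positivity)]
  have hE := Real.exp_pos x
  rcases le_total 0 x with hx | hx
  · have h1 := Real.quadratic_le_exp_of_nonneg hx
    have h2 : x ^ 2 ≤ 2 * Real.exp x := by linarith
    nlinarith [mul_le_mul_of_nonneg_left h2 hE.le]
  · have h1 := Real.quadratic_le_exp_of_nonneg (neg_nonneg.2 hx)
    have h2 : x ^ 2 ≤ 2 * Real.exp (-x) := by nlinarith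
    have h3 : Real.exp x * Real.exp (-x) = 1 := by rw [← Real.exp_add]; simp
    nlinarith [mul_le_mul_of_nonneg_left h2 hE.le]

theorem aux_ratio (x : ℝ) : |(1 - Real.exp x) / (1 + Real.exp x)| ≤ 1 := by
  have hE := Real.exp_pos x
  rw [abs_div, abs_of_pos (by positivity : 0 < 1 + Real.exp x), div_le_one (by positivity), abs_le]
  constructor <;> linarith

theorem aux_alpha (L d c a m B δ : ℝ) (hL0 : 0 ≤ L) (hL1 : L ≤ 1) (hL2 : L * d ^ 2 ≤ 2)
    (hd : d = c + a * m) (hc : |c| ≤ B) (hδ : 0 < δ) (hm : δ ≤ |m|) :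
    L * a ^ 2 ≤ (4 + 2 * B ^ 2) / δ ^ 2 := by
  rw [le_div_iff₀ (by positivity)]
  have h1 : δ ^ 2 ≤ m ^ 2 := by rw [← sq_abs m]; gcongr
  have h2 : c ^ 2 ≤ B ^ 2 := by rw [← sq_abs c]; gcongr
  have h3 : a ^ 2 * δ ^ 2 ≤ 2 * d ^ 2 + 2 * B ^ 2 := by
    have : a ^ 2 * δ ^ 2 ≤ a ^ 2 * m ^ 2 := by gcongr
    have e : a ^ 2 * m ^ 2 = (d - c) ^ 2 := by rw [hd]; ring
    nlinarith [sq_nonneg (d + c)]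
  have h4 := mul_le_mul_of_nonneg_left h3 hL0
  nlinarith [mul_le_mul_of_nonneg_right hL1 (sq_nonneg B)]

theorem aux_entry (L r m R x y s a W P : ℝ) (hL0 : 0 ≤ L) (hL1 : L ≤ 1)
    (hP : L * a ^ 2 ≤ P) (hr : |r| ≤ 1) (hm : |m| ≤ R) (hW : 0 ≤ W)
    (hx : |x| ≤ |a| + W) (hy : |y| ≤ |a| + W) (hs : |s| ≤ 2 * |a| + W) :
    (-m * L * r * (x * y) - L * s) ^ 2 ≤ (R * (2 * P + 2 * W ^ 2) + (1 + W + P)) ^ 2 := by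
  have hR : 0 ≤ R := (abs_nonneg m).trans hm
  have ha := abs_nonneg a
  have e : |a| ^ 2 = a ^ 2 := sq_abs a
  have h1 : |x| * |y| ≤ 2 * a ^ 2 + 2 * W ^ 2 := by
    calc |x| * |y| ≤ (|a| + W) * (|a| + W) := by gcongr
      _ ≤ _ := by nlinarith [sq_nonneg (|a| - W)]
  have h2 : L * (|x| * |y|) ≤ 2 * P + 2 * W ^ 2 := by
    have := mul_le_mul_of_nonneg_left h1 hL0
    nlinarith [mul_le_mul_of_nonneg_right hL1 (sq_nonneg W)]
  have h3 : L * |s| ≤ 1 + W + P := by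
    have h : |s| ≤ a ^ 2 + 1 + W := by nlinarith [sq_nonneg (|a| - 1)]
    have := mul_le_mul_of_nonneg_left h hL0
    nlinarith [mul_le_mul_of_nonneg_right hL1 hW]
  have h4 : |-m * L * r * (x * y)| ≤ R * (2 * P + 2 * W ^ 2) := by
    calc |-m * L * r * (x * y)| = |m| * |r| * (L * (|x| * |y|)) := by
          simp only [abs_mul, abs_neg, abs_of_nonneg hL0]; ring
      _ ≤ R * 1 * (2 * P + 2 * W ^ 2) := by gcongr
      _ = _ := by ring
  have h5 : |L * s| ≤ 1 + W + P := by rwa [abs_mul, abs_of_nonneg hL0]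
  rw [← sq_abs (_ - _)]
  gcongr
  exact (abs_sub _ _).trans (add_le_add h4 h5)

theorem aux_main
    (k : ℕ) (KW : Set (Fin k → ℝ)) (hKW : IsCompact KW)
    (Nμ : Set (ℝ × (Fin k → ℝ))) (hNμc : IsCompact Nμ)
    (hNμaway : ∃ δ : ℝ, 0 < δ ∧ ∀ μ ∈ Nμ, δ ≤ |μ.1|) :
    ∃ M : ℝ, ∀ (α : ℝ), ∀ w ∈ KW, ∀ μ ∈ Nμ,
        frobSq k (logitSecondMixedDeriv k α w μ.1 μ.2) ≤ M := by
  obtain ⟨δ, hδ, haway⟩ := hNμaway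
  obtain ⟨W, hW⟩ := hKW.exists_bound_of_continuousOn (f := fun w => w) continuousOn_id
  obtain ⟨R, hR⟩ := hNμc.exists_bound_of_continuousOn (f := fun μ => μ.1) continuous_fst.continuousOn
  obtain ⟨B, hB⟩ := (hKW.prod hNμc).exists_bound_of_continuousOn
    (f := fun p => p.1 ⬝ᵥ p.2.2) (by
      apply Continuous.continuousOn
      unfold dotProduct
      fun_prop)
  refine ⟨∑ i : Fin (k + 1), ∑ j : Fin (k + 1), (R * (2 * ((4 + 2 * B ^ 2) / δ ^ 2) + 2 * W ^ 2)
    + (1 + W + (4 + 2 * B ^ 2) / δ ^ 2)) ^ 2, ?_⟩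
  intro α w hw μ hμ
  have hW0 : 0 ≤ W := (norm_nonneg _).trans (hW w hw)
  have hwi : ∀ i, |w i| ≤ W := fun i => (norm_le_pi_norm w i).trans (hW w hw)
  have hv : ∀ i, |(Fin.cons α w : Fin (k + 1) → ℝ) i| ≤ |α| + W := by
    intro i
    refine Fin.cases ?_ (fun i => ?_) i
    · simpa using hW0
    · have := hwi i
      have := abs_nonneg α
      simp only [Fin.cons_succ]; linarith
  unfold frobSq
  refine Finset.sum_le_sum fun i _ => Finset.sum_le_sum fun j _ => ?_
  have hP := aux_alpha _ _ _ α μ.1 B δ (aux_L_nonneg _) (aux_L_le_one _)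
    (aux_L_sq (logitIndex k w α μ.1 μ.2)) rfl (hB (w, μ) ⟨hw, hμ⟩) hδ (haway μ hμ)
  have key := fun s hs => aux_entry _ _ μ.1 R _ _ s α W _ (aux_L_nonneg _) (aux_L_le_one _) hP
    (aux_ratio (logitIndex k w α μ.1 μ.2)) (hR μ hμ) hW0 (hv i) (hv j) hs
  unfold logitSecondMixedDeriv
  simp only [mul_assoc] at key ⊢
  apply key
  have hα := abs_nonneg α
  refine Fin.cases ?_ (fun i => ?_) i <;> refine Fin.cases ?_ (fun j => ?_) j
  · simp [abs_mul, hW0]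
  · have := hwi j
    simp only [Fin.cons_zero, Fin.cons_succ]; linarith
  · have := hwi i
    simp only [Fin.cons_zero, Fin.cons_succ]; linarith
  · simp only [Fin.cons_succ, abs_zero]; positivity

/-- **Proposition C.1 (iii).**  Let `K_W ⊆ ℝᵏ` be compact, `μ₀ = (μ₀₁, μ₀₋)` with `μ₀₁ ≠ 0`,
and let `N(μ₀)` be a compact neighborhood of `μ₀` on which the first coordinate is bounded
away from `0`.  Then the squared Frobenius norm of `∂²m/∂α∂μ'` is uniformly bounded by a
finite constant over `(α, w, μ) ∈ ℝ × K_W × N(μ₀)`; in particular there is a bounded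
(hence integrable) function `F(w)` with
`sup_{α ∈ ℝ, μ ∈ N(μ₀)} ‖∂²m/∂α∂μ'‖² ≤ F(w)` for all `w ∈ K_W`. -/
theorem logit_second_mixed_deriv_frobSq_uniformly_bounded
    (k : ℕ) (KW : Set (Fin k → ℝ)) (hKW : IsCompact KW)
    (μ01 : ℝ) (μ0m : Fin k → ℝ) (hμ01 : μ01 ≠ 0)
    (Nμ : Set (ℝ × (Fin k → ℝ))) (hNμc : IsCompact Nμ)
    (hNμnhds : Nμ ∈ nhds (μ01, μ0m))
    (hNμaway : ∃ δ : ℝ, 0 < δ ∧ ∀ μ ∈ Nμ, δ ≤ |μ.1|) :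
    (∃ M : ℝ, ∀ (α : ℝ), ∀ w ∈ KW, ∀ μ ∈ Nμ,
        frobSq k (logitSecondMixedDeriv k α w μ.1 μ.2) ≤ M) ∧
      ∃ F : (Fin k → ℝ) → ℝ, (∃ C : ℝ, ∀ w, |F w| ≤ C) ∧
        ∀ w ∈ KW, ∀ (α : ℝ), ∀ μ ∈ Nμ,
          frobSq k (logitSecondMixedDeriv k α w μ.1 μ.2) ≤ F w := by
  obtain ⟨M, hM⟩ := aux_main k KW hKW Nμ hNμc hNμaway
  exact ⟨⟨M, hM⟩, fun _ => M, ⟨|M|, fun _ => le_rfl⟩, fun w hw α μ hμ => hM α w hw μ hμ⟩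
end
end

section
/- (Orthogonal-moment identities of Section 3.) Let (X, α, W, Y_T, X_T) be random elements on a probability space with β₀ a fixed vector, and suppose E[Y_T − X_T'β₀ − α | X, α] = 0 almost surely. Then: (a) for any σ(X,α)-measurable function a(X,α,μ) such that a(X,α,μ)·(Y_T − X_T'β₀ − α) is integrable, E[a(X,α,μ)(Y_T − X_T'β₀ − α)] = 0; hence the modified moment m*(W,α,Z,β₀,μ,a) = m(W,α,μ) + a(X,α,μ)(Y_T − X_T'β₀ − α) satisfies E[m*(W,α,Z,β₀,μ,a)] = E[m(W,α,μ)] for every μ, so μ₀ solves E[m*] = 0 if and only if it solves E[m] = 0. (b) If additionally a(X,α,μ₀) = E[∂m(W,α,μ₀)/∂α | X, α] and ∂a(X,α,μ₀)/∂α is σ(X,α)-measurable with ∂a/∂α·(Y_T − X_T'β₀ − α) integrable, then the derivative ∂m*/∂α = ∂m(W,α,μ₀)/∂α − a(X,α,μ₀) − (∂a(X,α,μ₀)/∂α)(Y_T − X_T'β₀ − α) satisfies E[∂m*/∂α | X, α] = 0 almost surely, and hence E[∂m*/∂α] = 0 (Neyman orthogonality). -/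
open MeasureTheory Matrix

noncomputable section

/-- **Orthogonal-moment identities of Section 3.**
Let `(X, α, W, Y_T, X_T)` be random elements with `β₀` fixed and
`E[Y_T − X_T'β₀ − α | X, α] = 0` a.s. (the conditional information `σ(X,α)` is the
sub-σ-algebra `𝔛`).  Then:
(a) for any `σ(X,α)`-measurable `a(X,α,μ)` with `a·(Y_T − X_T'β₀ − α)` integrable,
    `E[a(X,α,μ)(Y_T − X_T'β₀ − α)] = 0`; hence the modified moment
    `m* = m + a·(Y_T − X_T'β₀ − α)` satisfies `E[m*] = E[m]` for every `μ`, so `μ₀` solves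
    `E[m*] = 0` iff it solves `E[m] = 0`;
(b) if moreover `a(X,α,μ₀) = E[∂m/∂α | X,α]` and `∂a/∂α` is `σ(X,α)`-measurable with
    `∂a/∂α·(Y_T − X_T'β₀ − α)` integrable, then
    `∂m*/∂α = ∂m/∂α − a − (∂a/∂α)(Y_T − X_T'β₀ − α)` satisfies
    `E[∂m*/∂α | X,α] = 0` a.s. and hence `E[∂m*/∂α] = 0` (Neyman orthogonality). -/
theorem orthogonal_moment_identities
    {Ω : Type} [mΩ : MeasurableSpace Ω] (P : Measure Ω) [IsProbabilityMeasure P]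
    -- σ(X,α): the sub-σ-algebra generated by (X, α)
    (𝔛 : MeasurableSpace Ω) (h𝔛 : 𝔛 ≤ mΩ)
    -- the data (Y_T, X_T, α) and the fixed coefficient vector β₀
    (p : ℕ) (YT : Ω → ℝ) (XT : Ω → Fin p → ℝ) (αr : Ω → ℝ) (β0 : Fin p → ℝ)
    (hres_int : Integrable (fun ω => YT ω - XT ω ⬝ᵥ β0 - αr ω) P)
    -- the conditional moment restriction E[Y_T − X_T'β₀ − α | X, α] = 0 a.s.
    (hres : P[(fun ω => YT ω - XT ω ⬝ᵥ β0 - αr ω)|𝔛] =ᵐ[P] 0)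
    -- the moment function m(W,α,μ) and the adjustment function a(X,α,μ), as functions of μ
    {Mt : Type} (μ0 : Mt) (m : Mt → Ω → ℝ) (a : Mt → Ω → ℝ)
    (hm_int : ∀ μ, Integrable (m μ) P)
    (ha_meas : ∀ μ, StronglyMeasurable[𝔛] (a μ))
    (ha_int : ∀ μ, Integrable (fun ω => a μ ω * (YT ω - XT ω ⬝ᵥ β0 - αr ω)) P)
    -- ingredients for (b): ∂m/∂α at μ₀, a(·,μ₀) = E[∂m/∂α | X,α], and ∂a/∂α
    (Dm : Ω → ℝ) (hDm_int : Integrable Dm P)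
    (ha0 : a μ0 =ᵐ[P] P[Dm|𝔛])
    (Da : Ω → ℝ) (hDa_meas : StronglyMeasurable[𝔛] Da)
    (hDa_int : Integrable (fun ω => Da ω * (YT ω - XT ω ⬝ᵥ β0 - αr ω)) P) :
    -- (a)
    ((∀ μ, ∫ ω, a μ ω * (YT ω - XT ω ⬝ᵥ β0 - αr ω) ∂P = 0) ∧
      (∀ μ, ∫ ω, (m μ ω + a μ ω * (YT ω - XT ω ⬝ᵥ β0 - αr ω)) ∂P = ∫ ω, m μ ω ∂P) ∧
      ((∫ ω, (m μ0 ω + a μ0 ω * (YT ω - XT ω ⬝ᵥ β0 - αr ω)) ∂P = 0) ↔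
        (∫ ω, m μ0 ω ∂P = 0))) ∧
    -- (b)
    (P[(fun ω => Dm ω - a μ0 ω - Da ω * (YT ω - XT ω ⬝ᵥ β0 - αr ω))|𝔛] =ᵐ[P] 0 ∧
      ∫ ω, (Dm ω - a μ0 ω - Da ω * (YT ω - XT ω ⬝ᵥ β0 - αr ω)) ∂P = 0) := by
  have key : ∀ b : Ω → ℝ, StronglyMeasurable[𝔛] b →
      Integrable (fun ω => b ω * (YT ω - XT ω ⬝ᵥ β0 - αr ω)) P →
      P[(fun ω => b ω * (YT ω - XT ω ⬝ᵥ β0 - αr ω))|𝔛] =ᵐ[P] 0 := by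
    intro b hb hbi
    have h := condExp_mul_of_stronglyMeasurable_left (μ := P) hb hbi hres_int
    refine h.trans ?_
    filter_upwards [hres] with ω hω
    simp [hω]
  have zero : ∀ f : Ω → ℝ, P[f|𝔛] =ᵐ[P] 0 → ∫ ω, f ω ∂P = 0 := by
    intro f hf
    rw [← integral_condExp h𝔛, integral_congr_ae hf]
    simp
  have ha : ∀ μ, ∫ ω, a μ ω * (YT ω - XT ω ⬝ᵥ β0 - αr ω) ∂P = 0 :=
    fun μ => zero _ (key _ (ha_meas μ) (ha_int μ))
  have hs : ∀ μ, ∫ ω, (m μ ω + a μ ω * (YT ω - XT ω ⬝ᵥ β0 - αr ω)) ∂P = ∫ ω, m μ ω ∂P := by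
    intro μ
    rw [integral_add (hm_int μ) (ha_int μ), ha μ, add_zero]
  have hai : Integrable (a μ0) P := integrable_condExp.congr ha0.symm
  have hb : P[(fun ω => Dm ω - a μ0 ω - Da ω * (YT ω - XT ω ⬝ᵥ β0 - αr ω))|𝔛] =ᵐ[P] 0 := by
    have h1 := condExp_sub (hDm_int.sub hai) hDa_int 𝔛
    have h2 := condExp_sub hDm_int hai 𝔛
    have h3 : P[a μ0|𝔛] = a μ0 := condExp_of_stronglyMeasurable h𝔛 (ha_meas μ0) hai
    refine Filter.EventuallyEq.trans h1 ?_
    filter_upwards [h2, key _ hDa_meas hDa_int, ha0] with ω e2 e3 e4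
    rw [Pi.sub_apply, e2, e3, Pi.sub_apply, h3, e4]
    simp
  exact ⟨⟨ha, hs, by rw [hs]⟩, hb, zero _ hb⟩
end
end
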